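/- Discrete comparison principle: let φ : ℤ^d → ℝ satisfy ‖φ‖_Lip < ∞, and let μ be the finite time-horizon value function with running cost p·α and terminal cost φ. Then for every x ∈ ℤ^d and every t ≥ 0, μ(x,t) ≥ φ(x) − t · sup_{y∈ℤ^d} 𝓗(φ,p,y). -/

import Mathlib

open MeasureTheory Filter

noncomputable section

/-- The set `A` of signed standard basis vectors of `ℤ^d`. -/
def dirs (d : ℕ) : Finset (Fin d → ℤ) :=
  Finset.univ.image (fun ib : Fin d × Bool =>
    if ib.2 then Pi.single ib.1 1 else -Pi.single ib.1 1)

/-- The inner product `p·α` of `p ∈ ℝ^d` with a lattice vector `α ∈ ℤ^d`. -/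
def pdot {d : ℕ} (p : Fin d → ℝ) (α : Fin d → ℤ) : ℝ := ∑ i, p i * (α i : ℝ)

/-- The `ℓ∞` norm of `p ∈ ℝ^d`. -/
def linf {d : ℕ} (p : Fin d → ℝ) : ℝ := ⨆ i, |p i|

/-- The `ℓ¹` norm of a lattice point. -/
def zl1 {d : ℕ} (x : Fin d → ℤ) : ℝ := ∑ i, |(x i : ℝ)|

/-- The discrete Hamiltonian `𝓗(φ,p,x) = max_{α∈A} (−𝒟φ(x,α) − p·α)/τ(x,α)`. -/
def ham {d : ℕ} (τ : (Fin d → ℤ) → (Fin d → ℤ) → ℝ) (p : Fin d → ℝ)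
    (φ : (Fin d → ℤ) → ℝ) (x : Fin d → ℤ) : ℝ :=
  sSup {r : ℝ | ∃ α ∈ dirs d, r = (-(φ (x + α) - φ x) - pdot p α) / τ x α}

/-- `v` is a nearest-neighbor path of length `k` starting at `x`. -/
def IsPath {d : ℕ} (x : Fin d → ℤ) (k : ℕ) (v : ℕ → Fin d → ℤ) : Prop :=
  v 0 = x ∧ ∀ i < k, v (i + 1) - v i ∈ dirs d

/-- Total weight (travel time) of the first `k` steps of a path. -/
def pathWeight {d : ℕ} (τ : (Fin d → ℤ) → (Fin d → ℤ) → ℝ) (k : ℕ)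
    (v : ℕ → Fin d → ℤ) : ℝ :=
  ∑ i ∈ Finset.range k, τ (v i) (v (i + 1) - v i)

/-- Total running cost `Σ p·(v_{i+1} − v_i)` of the first `k` steps of a path. -/
def pathCost {d : ℕ} (p : Fin d → ℝ) (k : ℕ) (v : ℕ → Fin d → ℤ) : ℝ :=
  ∑ i ∈ Finset.range k, pdot p (v (i + 1) - v i)

/-- The discrete finite time-horizon value function `μ(x,t)`. -/
def valueFn {d : ℕ} (τ : (Fin d → ℤ) → (Fin d → ℤ) → ℝ) (p : Fin d → ℝ)
    (φ : (Fin d → ℤ) → ℝ) (x : Fin d → ℤ) (t : ℝ) : ℝ :=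
  sInf {r : ℝ | ∃ (k : ℕ) (v : ℕ → Fin d → ℤ), IsPath x k v ∧
    pathWeight τ k v ≤ t ∧ r = pathCost p k v + φ (v k)}

lemma neg_mem_dirs {d : ℕ} {α : Fin d → ℤ} (hα : α ∈ dirs d) : -α ∈ dirs d := by
  simp only [dirs, Finset.mem_image, Finset.mem_univ, true_and] at hα ⊢
  obtain ⟨⟨i, s⟩, rfl⟩ := hα
  exact ⟨(i, !s), by cases s <;> simp⟩

lemma single_mem_dirs {d : ℕ} (i : Fin d) : (Pi.single i 1 : Fin d → ℤ) ∈ dirs d := by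
  simp only [dirs, Finset.mem_image, Finset.mem_univ, true_and]
  exact ⟨(i, true), by simp⟩

lemma pdot_neg {d : ℕ} (p : Fin d → ℝ) (α : Fin d → ℤ) : pdot p (-α) = -pdot p α := by
  simp [pdot]

/-- For Lipschitz `φ` and weights bounded below by `a > 0`, the difference quotients defining
the Hamiltonian are bounded uniformly in space and direction. -/
lemma exists_bound_ham_quotient {d : ℕ} {a : ℝ} (ha : 0 < a)
    {τ : (Fin d → ℤ) → (Fin d → ℤ) → ℝ} (hτ : ∀ x, ∀ α ∈ dirs d, a ≤ τ x α)
    (p : Fin d → ℝ) {φ : (Fin d → ℤ) → ℝ} {C : ℝ}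
    (hφ : ∀ x y, |φ x - φ y| ≤ C * zl1 (x - y)) :
    ∃ M, 0 ≤ M ∧ ∀ y, ∀ α ∈ dirs d,
      (-(φ (y + α) - φ y) - pdot p α) / τ y α ≤ M := by
  refine ⟨∑ α ∈ dirs d, (|C * zl1 α| + |pdot p α|) / a,
    Finset.sum_nonneg fun α _ => by positivity, fun y α hα => ?_⟩
  have h1 := hφ (y + α) y
  rw [add_sub_cancel_left] at h1
  calc (-(φ (y + α) - φ y) - pdot p α) / τ y α
      ≤ (|C * zl1 α| + |pdot p α|) / τ y α := by
        have := ha.trans_le (hτ y α hα)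
        gcongr
        linarith [neg_abs_le (φ (y + α) - φ y), neg_abs_le (pdot p α), le_abs_self (C * zl1 α)]
    _ ≤ (|C * zl1 α| + |pdot p α|) / a := by
        gcongr
        exact hτ y α hα
    _ ≤ _ := Finset.single_le_sum
        (f := fun α => (|C * zl1 α| + |pdot p α|) / a) (fun α _ => by positivity) hα

/-- One-step inequality satisfied by a Lipschitz function along an edge. -/
lemma sub_sub_pdot_le_iSup_ham_mul {d : ℕ} {a : ℝ} (ha : 0 < a)
    {τ : (Fin d → ℤ) → (Fin d → ℤ) → ℝ} (hτ : ∀ x, ∀ α ∈ dirs d, a ≤ τ x α)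
    (p : Fin d → ℝ) {φ : (Fin d → ℤ) → ℝ} {C : ℝ}
    (hφ : ∀ x y, |φ x - φ y| ≤ C * zl1 (x - y))
    (y : Fin d → ℤ) {α : Fin d → ℤ} (hα : α ∈ dirs d) :
    φ y - φ (y + α) - pdot p α ≤ (⨆ z, ham τ p φ z) * τ y α := by
  obtain ⟨M, hM0, hM⟩ := exists_bound_ham_quotient ha hτ p hφ
  have hle : ham τ p φ y ≤ ⨆ z, ham τ p φ z := by
    refine le_ciSup (f := fun z => ham τ p φ z) ⟨M, ?_⟩ y
    rintro _ ⟨z, rfl⟩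
    refine Real.sSup_le ?_ hM0
    rintro _ ⟨β, hβ, rfl⟩
    exact hM z β hβ
  have hquot : (-(φ (y + α) - φ y) - pdot p α) / τ y α ≤ ham τ p φ y := by
    refine le_csSup ⟨M, ?_⟩ ⟨α, hα, rfl⟩
    rintro _ ⟨β, hβ, rfl⟩
    exact hM y β hβ
  have := (div_le_iff₀ (ha.trans_le (hτ y α hα))).1 (hquot.trans hle)
  linarith

/-- The supremum of the Hamiltonian is nonnegative: traverse an edge back and forth. -/
lemma iSup_ham_nonneg {d : ℕ} (hd : 1 ≤ d) {a : ℝ} (ha : 0 < a)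
    {τ : (Fin d → ℤ) → (Fin d → ℤ) → ℝ} (hτ : ∀ x, ∀ α ∈ dirs d, a ≤ τ x α)
    (p : Fin d → ℝ) {φ : (Fin d → ℤ) → ℝ} {C : ℝ}
    (hφ : ∀ x y, |φ x - φ y| ≤ C * zl1 (x - y)) :
    0 ≤ ⨆ z, ham τ p φ z := by
  have hα := single_mem_dirs (⟨0, hd⟩ : Fin d)
  set α : Fin d → ℤ := Pi.single ⟨0, hd⟩ 1
  have h1 := sub_sub_pdot_le_iSup_ham_mul ha hτ p hφ 0 hα
  have h2 := sub_sub_pdot_le_iSup_ham_mul ha hτ p hφ α (neg_mem_dirs hα)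
  rw [zero_add] at h1
  rw [add_neg_cancel, pdot_neg] at h2
  have h3 := hτ 0 α hα
  have h4 := hτ α (-α) (neg_mem_dirs hα)
  by_contra! hneg
  nlinarith

/-- discrete comparison principle. For Lipschitz terminal cost `φ`,
`μ(x,t) ≥ φ(x) − t·sup_y 𝓗(φ,p,y)`. -/
theorem stmt4 {d : ℕ} (hd : 1 ≤ d) {a b : ℝ} (ha : 0 < a) (hab : a ≤ b)
    (τ : (Fin d → ℤ) → (Fin d → ℤ) → ℝ)
    (hτ : ∀ x, ∀ α ∈ dirs d, a ≤ τ x α ∧ τ x α ≤ b)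
    (p : Fin d → ℝ) (φ : (Fin d → ℤ) → ℝ)
    (C : ℝ) (hφlip : ∀ x y, |φ x - φ y| ≤ C * zl1 (x - y))
    (x : Fin d → ℤ) (t : ℝ) (ht : 0 ≤ t) :
    φ x - t * (⨆ y : Fin d → ℤ, ham τ p φ y) ≤ valueFn τ p φ x t := by
  have hτ' : ∀ x, ∀ α ∈ dirs d, a ≤ τ x α := fun x α hα => (hτ x α hα).1
  refine le_csInf ⟨_, 0, fun _ => x, ⟨rfl, by simp⟩, by simpa [pathWeight] using ht, rfl⟩ ?_
  rintro _ ⟨k, v, ⟨rfl, hv⟩, hw, rfl⟩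
  have hpath : φ (v 0) - φ (v k) - pathCost p k v
      ≤ (⨆ y, ham τ p φ y) * pathWeight τ k v := by
    rw [← Finset.sum_range_sub' (fun i => φ (v i)) k, pathCost, pathWeight,
      ← Finset.sum_sub_distrib, Finset.mul_sum]
    refine Finset.sum_le_sum fun i hi => ?_
    have h := sub_sub_pdot_le_iSup_ham_mul ha hτ' p hφlip (v i) (hv i (Finset.mem_range.1 hi))
    rwa [add_sub_cancel] at h
  have := mul_le_mul_of_nonneg_left hw (iSup_ham_nonneg hd ha hτ' p hφlip)
  linarith
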